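/- arXiv:0804.3984 — 5 statements merged into one kernel-verified Lean document; each statement's English description precedes it below -/
import Mathlib

section
/- Let K be a finite group and let π : G → K be a surjective group homomorphism from the amalgamated free product G = A *_C B such that π(j_C(C)) = K. Then the kernel of π is generated by the two subgroups j_A(ker(π ∘ j_A)) and j_B(ker(π ∘ j_B)); that is, ker π is the join (supremum) of the image under j_A of the kernel of π ∘ j_A and the image under j_B of the kernel of π ∘ j_B. -/
open Monoid

namespace Monoid.PushoutI

variable {ι C K : Type*} [Group C] {A : ι → Type*} [∀ i, Group (A i)] {φ : ∀ i, C →* A i}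
  [Group K] (π : PushoutI φ →* K)

/-- The subgroup generated by the kernels of the restrictions of `π` to the factors. -/
def factorKer : Subgroup (PushoutI φ) :=
  ⨆ i, Subgroup.map (of (φ := φ) i) (π.comp (of i)).ker

lemma of_mem_factorKer {i : ι} {a : A i} (ha : π (of i a) = 1) : of i a ∈ factorKer π :=
  le_iSup (fun i => Subgroup.map (of (φ := φ) i) (π.comp (of i)).ker) i ⟨a, ha, rfl⟩

lemma factorKer_le_ker : factorKer π ≤ π.ker := by
  refine iSup_le fun i => ?_
  rintro _ ⟨a, ha, rfl⟩
  exact ha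

lemma conj_base_mem_factorKer (c : C) {n : PushoutI φ} (hn : n ∈ factorKer π) :
    base φ c * n * (base φ c)⁻¹ ∈ factorKer π := by
  have hle : factorKer π ≤ (factorKer π).comap (MulAut.conj (base φ c)).toMonoidHom := by
    refine iSup_le fun i => ?_
    rintro _ ⟨a, ha, rfl⟩
    have ha' : π (of i a) = 1 := ha
    have hconj : of i (φ i c * a * (φ i c)⁻¹) ∈ factorKer π :=
      of_mem_factorKer π (by simp [ha'])
    simpa [of_apply_eq_base] using hconj
  exact hle hn

lemma exists_mem_factorKer_mul_base (hbase : (π.comp (base φ)).range = ⊤) (g : PushoutI φ) :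
    ∃ n ∈ factorKer π, ∃ c, g = n * base φ c := by
  induction g using induction_on with
  | of i a =>
    obtain ⟨c, hc⟩ := MonoidHom.range_eq_top.mp hbase (π (of i a))
    have hc' : π (base φ c) = π (of i a) := hc
    refine ⟨of i (a * (φ i c)⁻¹), of_mem_factorKer π ?_, c, ?_⟩
    · simp [of_apply_eq_base, hc']
    · simp [of_apply_eq_base]
  | base c => exact ⟨1, one_mem _, c, (one_mul _).symm⟩
  | mul x y hx hy =>
    obtain ⟨n, hn, c, rfl⟩ := hx
    obtain ⟨m, hm, d, rfl⟩ := hy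
    refine ⟨n * (base φ c * m * (base φ c)⁻¹), mul_mem hn (conj_base_mem_factorKer π c hm),
      c * d, ?_⟩
    rw [map_mul]
    group

/-- If `π` is surjective on the base group, its kernel is generated by the kernels of its
restrictions to the factors. -/
theorem ker_eq_factorKer [Nonempty ι] (hbase : (π.comp (base φ)).range = ⊤) :
    π.ker = factorKer π := by
  refine le_antisymm (fun g hg => ?_) (factorKer_le_ker π)
  obtain ⟨n, hn, c, rfl⟩ := exists_mem_factorKer_mul_base π hbase g
  have hc : base φ c ∈ π.ker :=
    (Subgroup.mul_mem_cancel_left _ (factorKer_le_ker π hn)).mp hg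
  obtain ⟨i⟩ := ‹Nonempty ι›
  rw [← of_apply_eq_base φ i] at hc ⊢
  exact mul_mem hn (of_mem_factorKer π hc)

end Monoid.PushoutI

/-- For an amalgamated free product `G = A *_C B` (formalized as the
pushout `Monoid.PushoutI φ` of an injective family `φ i : C →* A i` indexed by `Bool`),
a surjective homomorphism `π : G →* K` to a finite group `K` with `π (j_C (C)) = K`
has kernel generated by (i.e. equal to the join of) `j_A (ker (π ∘ j_A))` and
`j_B (ker (π ∘ j_B))`. -/
theorem stmt_0 {C : Type} [Group C] {A : Bool → Type} [∀ i, Group (A i)]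
    (φ : ∀ i : Bool, C →* A i) (hφ : ∀ i, Function.Injective (φ i))
    {K : Type} [Group K] [Finite K]
    (π : PushoutI φ →* K) (hπ : Function.Surjective π)
    (hbase : (π.comp (PushoutI.base φ)).range = ⊤) :
    π.ker =
      Subgroup.map (PushoutI.of (φ := φ) true) (π.comp (PushoutI.of (φ := φ) true)).ker ⊔
      Subgroup.map (PushoutI.of (φ := φ) false) (π.comp (PushoutI.of (φ := φ) false)).ker := by
  rw [PushoutI.ker_eq_factorKer π hbase, PushoutI.factorKer, iSup_bool_eq]
end

section
/- Let K be a finite group and let π : G → K be a surjective group homomorphism from the amalgamated free product G = A *_C B such that π(j_C(C)) = K. Set A' = ker(π ∘ j_A) ≤ A, B' = ker(π ∘ j_B) ≤ B, C' = ker(π ∘ j_C) ≤ C, and note that ι_A and ι_B restrict to injective homomorphisms C' → A' and C' → B'. Then the homomorphism Φ : A' *_{C'} B' → G induced (via the universal property of the pushout) by the restrictions of j_A to A' and of j_B to B' is injective, and its range is exactly ker π. In particular ker π is isomorphic to the amalgamated free product (ker π|_A) *_{ker π|_C} (ker π|_B). -/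
open Monoid

namespace Monoid.PushoutI

variable {ι : Type*} {G G' : ι → Type*} {H H' : Type*}
  [∀ i, Group (G i)] [∀ i, Group (G' i)] [Group H] [Group H']
  {φ : ∀ i, H →* G i} {ψ : ∀ i, H' →* G' i}

/-- Every element of an amalgamated product is a base element times a reduced word. -/
theorem exists_reduced_eq (hφ : ∀ i, Function.Injective (φ i)) (x : PushoutI φ) :
    ∃ (h : H) (w : CoprodI.Word G), Reduced φ w ∧ x = base φ h * ofCoprodI w.prod := by
  classical
  obtain ⟨d⟩ := NormalWord.transversal_nonempty φ hφ
  obtain ⟨w, rfl⟩ := (NormalWord.equiv (d := d)).symm.surjective x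
  refine ⟨w.head, w.toWord, fun p hp hr => w.ne_one p hp ?_, rfl⟩
  have h₁ := (Subgroup.IsComplement.coe_equiv_snd_eq_one_iff_mem (d.compl p.1)
    (d.one_mem _)).2 hr
  rwa [(Subgroup.IsComplement.equiv_snd_eq_self_iff_mem (d.compl p.1) (one_mem _)).2
    (w.normalized p.1 p.2 hp)] at h₁

/-- The image of a word under a family of injective homomorphisms. -/
def mapWord (f : ∀ i, G i →* G' i) (hf : ∀ i, Function.Injective (f i))
    (w : CoprodI.Word G) : CoprodI.Word G' where
  toList := w.toList.map fun p => ⟨p.1, f p.1 p.2⟩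
  ne_one := by
    intro q hq
    obtain ⟨p, hp, rfl⟩ := List.mem_map.1 hq
    exact fun h => w.ne_one p hp ((map_eq_one_iff _ (hf p.1)).1 h)
  chain_ne := by
    rw [List.isChain_map]
    exact w.chain_ne

theorem map_ofCoprodI_prod {f : ∀ i, G i →* G' i} (hf : ∀ i, Function.Injective (f i))
    {F : PushoutI φ →* PushoutI ψ} (hF : ∀ i g, F (of i g) = of i (f i g))
    (w : CoprodI.Word G) :
    F (ofCoprodI w.prod) = ofCoprodI (mapWord f hf w).prod := by
  simp [CoprodI.Word.prod, mapWord, map_list_prod, List.map_map, Function.comp_def, hF]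

/-- A homomorphism of amalgamated products is injective if it is induced by injective
homomorphisms of the factors and of the base that reflect membership in the base. -/
theorem injective_of_reflects_range (hφ : ∀ i, Function.Injective (φ i))
    (hψ : ∀ i, Function.Injective (ψ i))
    {f : ∀ i, G i →* G' i} (hf : ∀ i, Function.Injective (f i))
    {k : H →* H'} (hk : Function.Injective k)
    (hr : ∀ i g, f i g ∈ (ψ i).range → g ∈ (φ i).range)
    {F : PushoutI φ →* PushoutI ψ} (hF : ∀ i g, F (of i g) = of i (f i g))
    (hFb : ∀ h, F (base φ h) = base ψ (k h)) : Function.Injective F := by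
  rw [injective_iff_map_eq_one]
  intro x hx
  obtain ⟨h, w, hw, rfl⟩ := exists_reduced_eq hφ x
  rw [map_mul, hFb, map_ofCoprodI_prod hf hF] at hx
  have hred : Reduced ψ (mapWord f hf w) := by
    intro q hq
    obtain ⟨p, hp, rfl⟩ := List.mem_map.1 hq
    exact fun hm => hw p hp (hr p.1 p.2 hm)
  have hempty := hred.eq_empty_of_mem_range hψ
    ⟨(k h)⁻¹, by rw [map_inv]; exact inv_eq_of_mul_eq_one_right hx⟩
  have hw0 : w = .empty := by
    ext1
    exact List.map_eq_nil_iff.1 (congrArg CoprodI.Word.toList hempty)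
  subst hw0
  rw [hempty] at hx
  simp only [CoprodI.Word.prod_empty, map_one, mul_one] at hx ⊢
  rw [← map_one (base ψ)] at hx
  rw [(map_eq_one_iff k hk).1 (base_injective hψ hx), map_one]

variable {K : Type*} [Group K]

/-- If `π` is surjective on the base, then a subgroup of `π.ker` which is normalized by the base
and contains all elements of the factors and of the base killed by `π` is equal to `π.ker`. -/
theorem eq_ker_of_surjective_base {π : PushoutI φ →* K}
    (hπ : Function.Surjective (π.comp (base φ))) {S : Subgroup (PushoutI φ)}
    (hS : S ≤ π.ker)
    (hof : ∀ i g, π (of i g) = 1 → of i g ∈ S) (hb : ∀ h, π (base φ h) = 1 → base φ h ∈ S)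
    (hconj : ∀ h, ∀ x ∈ S, base φ h * x * (base φ h)⁻¹ ∈ S) : S = π.ker := by
  have key (x : PushoutI φ) : ∃ h, ∃ y ∈ S, x = base φ h * y := by
    induction x using PushoutI.induction_on with
    | of i g =>
      obtain ⟨h, hh⟩ := hπ (π (of i g))
      rw [MonoidHom.comp_apply] at hh
      refine ⟨h, of i ((φ i h)⁻¹ * g), hof _ _ ?_, ?_⟩
      · rw [map_mul, map_inv, of_apply_eq_base, map_mul, map_inv, hh, inv_mul_cancel]
      · rw [map_mul, map_inv, of_apply_eq_base, mul_inv_cancel_left]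
    | base h => exact ⟨h, 1, S.one_mem, (mul_one _).symm⟩
    | mul x y hx hy =>
      obtain ⟨h, u, hu, rfl⟩ := hx
      obtain ⟨k, v, hv, rfl⟩ := hy
      refine ⟨h * k, _, S.mul_mem (hconj k⁻¹ u hu) hv, ?_⟩
      simp only [map_mul, map_inv, inv_inv]
      group
  refine le_antisymm hS fun x hx => ?_
  obtain ⟨h, y, hy, rfl⟩ := key x
  refine S.mul_mem (hb h ?_) hy
  rwa [MonoidHom.mem_ker, map_mul, hS hy, mul_one] at hx

end Monoid.PushoutI

/-- With `G = A *_C B` the pushout of an injective family `φ i : C →* A i`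
(indexed by `Bool`), `π : G →* K` surjective onto a finite group with `π (j_C (C)) = K`,
set `A' i = ker (π ∘ j_{A i})` and `C' = ker (π ∘ j_C)`.  The maps `φ i` restrict to
maps `φ' i : C' →* A' i`, and any homomorphism `Φ : A' *_{C'} B' →* G` induced by the
universal property (i.e. satisfying `Φ ∘ of i = j_{A i} ∘ incl` for each `i`) is
injective with range exactly `ker π`. -/
theorem stmt_1 {C : Type} [Group C] {A : Bool → Type} [∀ i, Group (A i)]
    (φ : ∀ i : Bool, C →* A i) (hφ : ∀ i, Function.Injective (φ i))
    {K : Type} [Group K] [Finite K]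
    (π : PushoutI φ →* K) (hπ : Function.Surjective π)
    (hbase : (π.comp (PushoutI.base φ)).range = ⊤)
    (φ' : ∀ i : Bool,
      (π.comp (PushoutI.base φ)).ker →* (π.comp (PushoutI.of (φ := φ) i)).ker)
    (hφ' : ∀ (i : Bool) (c : (π.comp (PushoutI.base φ)).ker),
      ((π.comp (PushoutI.of (φ := φ) i)).ker.subtype) (φ' i c) =
        φ i (((π.comp (PushoutI.base φ)).ker.subtype) c))
    (Φ : PushoutI φ' →* PushoutI φ)
    (hΦ : ∀ i : Bool, Φ.comp (PushoutI.of (φ := φ') i) =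
      (PushoutI.of (φ := φ) i).comp ((π.comp (PushoutI.of (φ := φ) i)).ker.subtype)) :
    Function.Injective Φ ∧ Φ.range = π.ker := by
  have hof (i : Bool) (g) : Φ (PushoutI.of i g) = PushoutI.of i (g : A i) :=
    DFunLike.congr_fun (hΦ i) g
  have hb (c) : Φ (PushoutI.base φ' c) = PushoutI.base φ (c : C) := by
    rw [← PushoutI.of_apply_eq_base φ' true, hof, ← PushoutI.of_apply_eq_base φ true]
    exact congrArg _ (hφ' true c)
  have hφ'inj (i : Bool) : Function.Injective (φ' i) := fun c d h => by
    apply Subtype.ext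
    apply hφ i
    exact (hφ' i c).symm.trans ((congrArg Subtype.val h).trans (hφ' i d))
  refine ⟨PushoutI.injective_of_reflects_range hφ'inj hφ
    (f := fun i => (π.comp (PushoutI.of (φ := φ) i)).ker.subtype)
    (fun i => Subtype.val_injective)
    (k := (π.comp (PushoutI.base φ)).ker.subtype) Subtype.val_injective ?_ hof hb, ?_⟩
  · rintro i ⟨g, hg⟩ ⟨c, rfl⟩
    refine ⟨⟨c, ?_⟩, Subtype.ext (hφ' i _)⟩
    rwa [MonoidHom.mem_ker, MonoidHom.comp_apply, PushoutI.of_apply_eq_base] at hg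
  · refine PushoutI.eq_ker_of_surjective_base (MonoidHom.range_eq_top.1 hbase) ?_
      (fun i g hg => ⟨PushoutI.of i ⟨g, hg⟩, hof i _⟩)
      (fun c hc => ⟨PushoutI.base φ' ⟨c, hc⟩, hb _⟩) ?_
    · rintro _ ⟨x, rfl⟩
      rw [MonoidHom.mem_ker]
      induction x using PushoutI.induction_on with
      | of i g => rw [hof]; exact g.2
      | base c => rw [hb]; exact c.2
      | mul x y hx hy => rw [map_mul, map_mul, hx, hy, one_mul]
    · rintro c _ ⟨x, rfl⟩
      induction x using PushoutI.induction_on with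
      | of i g =>
        refine ⟨PushoutI.of i ⟨φ i c * g * (φ i c)⁻¹,
          (MonoidHom.normal_ker _).conj_mem _ g.2 _⟩, ?_⟩
        simp only [hof, map_mul, map_inv, PushoutI.of_apply_eq_base]
      | base d =>
        refine ⟨PushoutI.base φ' ⟨c * d * c⁻¹,
          (MonoidHom.normal_ker _).conj_mem _ d.2 _⟩, ?_⟩
        simp only [hb, map_mul, map_inv]
      | mul x y hx hy =>
        have := Φ.range.mul_mem hx hy
        rwa [conj_mul, ← map_mul] at this
end

section
/- Let K be a group and π : G → K any group homomorphism from the amalgamated free product G = A *_C B. Then the intersection of the subgroups j_A(ker(π ∘ j_A)) and j_B(ker(π ∘ j_B)) of G equals j_C(ker(π ∘ j_C)). -/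
open Monoid

/-- For an amalgamated free product `G = A *_C B` (pushout of an injective
family indexed by `Bool`) and any group homomorphism `π : G →* K`, the intersection of
the subgroups `j_A (ker (π ∘ j_A))` and `j_B (ker (π ∘ j_B))` of `G` equals
`j_C (ker (π ∘ j_C))`. -/
theorem stmt_2 {C : Type} [Group C] {A : Bool → Type} [∀ i, Group (A i)]
    (φ : ∀ i : Bool, C →* A i) (hφ : ∀ i, Function.Injective (φ i))
    {K : Type} [Group K] (π : PushoutI φ →* K) :
    Subgroup.map (PushoutI.of (φ := φ) true) (π.comp (PushoutI.of (φ := φ) true)).ker ⊓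
      Subgroup.map (PushoutI.of (φ := φ) false) (π.comp (PushoutI.of (φ := φ) false)).ker =
      Subgroup.map (PushoutI.base φ) (π.comp (PushoutI.base φ)).ker := by
  ext g
  constructor
  · rintro ⟨⟨a, ha, rfl⟩, b, hb, hab⟩
    have hg : PushoutI.of (φ := φ) true a ∈ (PushoutI.base φ).range := by
      rw [← PushoutI.inf_of_range_eq_base_range hφ (i := true) (j := false) (by decide)]
      exact ⟨⟨a, rfl⟩, b, hab⟩
    obtain ⟨c, hc⟩ := hg
    refine ⟨c, ?_, hc⟩
    change π (PushoutI.base φ c) = 1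
    rw [hc]
    exact ha
  · rintro ⟨c, hc, rfl⟩
    have mem (i : Bool) : PushoutI.base φ c ∈
        Subgroup.map (PushoutI.of (φ := φ) i) (π.comp (PushoutI.of (φ := φ) i)).ker := by
      refine ⟨φ i c, ?_, PushoutI.of_apply_eq_base φ i c⟩
      change π (PushoutI.of i (φ i c)) = 1
      rw [PushoutI.of_apply_eq_base]
      exact hc
    exact ⟨mem true, mem false⟩
end

section
/- Let p and q be coprime integers with q ≥ 1. For z ∈ ℂ define the curve γ_z : ℝ → ℂ × ℂ by γ_z(t) = (z·exp(2πi·p·t), exp(2πi·q·t)). Then for nonzero z, w ∈ ℂ, the ranges of γ_z and γ_w are equal if and only if there is an integer k with w = z·exp(2πi·k/q). (These curves are the regular fibers of the Seifert fibering of the solid torus V_{p/q}; two points z, w of the disk determine the same fiber exactly when w/z is a q-th root of unity.) -/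
/-- Every point of the curve through `z·e^{2πi·k/q}` lies on the curve through `z`. -/
theorem seifert_fiber_point_mem (p q : ℤ) (hq : q ≠ 0) (hpq : Int.gcd p q = 1) (z : ℂ) (k : ℤ)
    (t : ℝ) :
    ∃ s : ℝ,
      z * Complex.exp (2 * (Real.pi : ℂ) * Complex.I * (p : ℂ) * (s : ℂ)) =
        z * Complex.exp (2 * (Real.pi : ℂ) * Complex.I * (k : ℂ) / (q : ℂ)) *
          Complex.exp (2 * (Real.pi : ℂ) * Complex.I * (p : ℂ) * (t : ℂ)) ∧
      Complex.exp (2 * (Real.pi : ℂ) * Complex.I * (q : ℂ) * (s : ℂ)) =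
        Complex.exp (2 * (Real.pi : ℂ) * Complex.I * (q : ℂ) * (t : ℂ)) := by
  obtain ⟨a, b, hab⟩ : IsCoprime p q := Int.isCoprime_iff_gcd_eq_one.mpr hpq
  have hqC : (q : ℂ) ≠ 0 := by exact_mod_cast hq
  have habC : (a : ℂ) * p + b * q = 1 := by exact_mod_cast hab
  refine ⟨t + k * a / q, ?_, ?_⟩
  · rw [mul_assoc z, ← Complex.exp_add]
    congr 1
    rw [Complex.exp_eq_exp_iff_exists_int]
    refine ⟨-(k * b), ?_⟩
    push_cast
    field_simp
    linear_combination (k : ℂ) * habC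
  · rw [Complex.exp_eq_exp_iff_exists_int]
    refine ⟨k * a, ?_⟩
    push_cast
    field_simp

/-- For coprime integers `p, q` with `q ≥ 1`, let
`γ_z (t) = (z·e^{2πi·pt}, e^{2πi·qt})`.  For nonzero `z, w ∈ ℂ`, the curves `γ_z` and
`γ_w` have the same range iff `w = z·e^{2πi·k/q}` for some integer `k`. -/
theorem stmt_8 (p q : ℤ) (hq : 1 ≤ q) (hpq : Int.gcd p q = 1)
    (γ : ℂ → ℝ → ℂ × ℂ)
    (hγ : ∀ (z : ℂ) (t : ℝ), γ z t =
      (z * Complex.exp (2 * (Real.pi : ℂ) * Complex.I * (p : ℂ) * (t : ℂ)),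
       Complex.exp (2 * (Real.pi : ℂ) * Complex.I * (q : ℂ) * (t : ℂ))))
    (z w : ℂ) (hz : z ≠ 0) (hw : w ≠ 0) :
    Set.range (γ z) = Set.range (γ w) ↔
      ∃ k : ℤ, w = z * Complex.exp (2 * (Real.pi : ℂ) * Complex.I * (k : ℂ) / (q : ℂ)) := by
  have hq0 : q ≠ 0 := by lia
  have hqC : (q : ℂ) ≠ 0 := by exact_mod_cast hq0
  constructor
  · intro h
    obtain ⟨t, ht⟩ : γ w 0 ∈ Set.range (γ z) := h ▸ Set.mem_range_self 0
    simp only [hγ, Prod.mk.injEq, Complex.ofReal_zero, mul_zero, Complex.exp_zero, mul_one] at ht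
    obtain ⟨hw', h1⟩ := ht
    obtain ⟨n, hn⟩ := Complex.exp_eq_one_iff.mp h1
    have hqt : (q : ℂ) * t = n := by
      apply mul_left_cancel₀ Complex.two_pi_I_ne_zero
      linear_combination hn
    refine ⟨p * n, ?_⟩
    rw [← hw', Int.cast_mul, ← hqt]
    congr 2
    field_simp
  · rintro ⟨k, hk⟩
    have hz' : z = w * Complex.exp (2 * (Real.pi : ℂ) * Complex.I * ((-k : ℤ) : ℂ) / (q : ℂ)) := by
      rw [hk, mul_assoc, ← Complex.exp_add]
      simp [neg_div]
    apply Set.Subset.antisymm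
    · rintro _ ⟨t, rfl⟩
      obtain ⟨s, h1, h2⟩ := seifert_fiber_point_mem p q hq0 hpq w (-k) t
      rw [← hz'] at h1
      exact ⟨s, by rw [hγ, hγ, h1, h2]⟩
    · rintro _ ⟨t, rfl⟩
      obtain ⟨s, h1, h2⟩ := seifert_fiber_point_mem p q hq0 hpq z k t
      rw [← hk] at h1
      exact ⟨s, by rw [hγ, hγ, h1, h2]⟩
end

section
/- Let Λ be the subgroup of F generated by the three elements h, h·x·h·x⁻², and (x·h·x)·h⁻¹·(x·h·x)⁻¹, and let G = F *_Λ F be the amalgamated free product of two copies of F over the inclusion Λ ↪ F (in both factors), with canonical injections j₁, j₂ : F → G. Fix an integer n ≥ 2 and an integer k, and let Π : G → ℤ/nℤ be the unique homomorphism with Π ∘ j₁ = Π ∘ j₂ = π_{n,k} (which exists since the two composites agree on Λ). Then ker Π is generated by the two subgroups j₁(ker π_{n,k}) and j₂(ker π_{n,k}) of G. (Here G is the fundamental group of the exterior of the doubled tangle L = DT in S³, Λ corresponds to the four-holed sphere ∂B³ ∩ ℯ(T), and the conclusion identifies the subgroup corresponding to the doubled branched cover DM_{n,k}.) -/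
open Monoid

/-- Conjugation by `f c` preserves the image under `f` of a normal subgroup. -/
theorem conj_mem_map_of_normal {A B : Type*} [Group A] [Group B] (f : A →* B)
    (N : Subgroup A) [N.Normal] (c : A) {s : B} (hs : s ∈ N.map f) :
    f c * s * (f c)⁻¹ ∈ N.map f := by
  obtain ⟨a, ha, rfl⟩ := hs
  exact ⟨c * a * c⁻¹, Subgroup.Normal.conj_mem inferInstance a ha c, by simp⟩

/-- If `π` maps some `c` in the amalgamated subgroup to an element whose powers exhaust the
target, the kernel of the induced map on the double `A *_Λ A` is generated by the two copies
of `ker π`. -/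
theorem ker_double_eq_sup {A C : Type*} [Group A] [Group C] (Λ : Subgroup A) (π : A →* C)
    (c : A) (hc : c ∈ Λ) (hsurj : ∀ z : C, ∃ m : ℤ, π c ^ m = z)
    (P : PushoutI (fun _ : Bool => Λ.subtype) →* C)
    (hP : ∀ i : Bool, P.comp (PushoutI.of (φ := fun _ : Bool => Λ.subtype) i) = π) :
    P.ker =
      Subgroup.map (PushoutI.of (φ := fun _ : Bool => Λ.subtype) true) π.ker ⊔
      Subgroup.map (PushoutI.of (φ := fun _ : Bool => Λ.subtype) false) π.ker := by
  set j := fun i : Bool => PushoutI.of (φ := fun _ : Bool => Λ.subtype) i with hj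
  change P.ker = Subgroup.map (j true) π.ker ⊔ Subgroup.map (j false) π.ker
  set S := Subgroup.map (j true) π.ker ⊔ Subgroup.map (j false) π.ker with hS
  have hPj (i : Bool) (a : A) : P (j i a) = π a := DFunLike.congr_fun (hP i) a
  have hjS (i : Bool) {a : A} (ha : a ∈ π.ker) : j i a ∈ S := by
    cases i
    · exact Subgroup.mem_sup_right ⟨a, ha, rfl⟩
    · exact Subgroup.mem_sup_left ⟨a, ha, rfl⟩
  have hbase (i : Bool) (m : ℤ) :
      j i (c ^ m) = PushoutI.base (fun _ : Bool => Λ.subtype) (⟨c, hc⟩ ^ m) :=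
    PushoutI.of_apply_eq_base (fun _ : Bool => Λ.subtype) i (⟨c, hc⟩ ^ m)
  have hconj (m : ℤ) {s} (hs : s ∈ S) : j true (c ^ m) * s * (j true (c ^ m))⁻¹ ∈ S := by
    have hle : S ≤ S.comap (MulAut.conj (j true (c ^ m))).toMonoidHom := by
      refine sup_le (fun s hs => ?_) (fun s hs => ?_)
      · exact Subgroup.mem_sup_left (conj_mem_map_of_normal (j true) π.ker (c ^ m) hs)
      · have := conj_mem_map_of_normal (j false) π.ker (c ^ m) hs
        rw [hbase false, ← hbase true] at this
        exact Subgroup.mem_sup_right this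
    exact hle hs
  have hof (i : Bool) (a : A) : ∃ s ∈ S, ∃ m : ℤ, j i a = s * j true (c ^ m) := by
    obtain ⟨m, hm⟩ := hsurj (π a)
    refine ⟨j i (a * (c ^ m)⁻¹), hjS i (by simp [MonoidHom.mem_ker, hm]), m, ?_⟩
    rw [hbase true, ← hbase i, ← map_mul, inv_mul_cancel_right]
  have hdecomp (y) : ∃ s ∈ S, ∃ m : ℤ, y = s * j true (c ^ m) := by
    induction y using PushoutI.induction_on with
    | of i a => exact hof i a
    | base b =>
      rw [← PushoutI.of_apply_eq_base (fun _ : Bool => Λ.subtype) true b]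
      exact hof true b
    | mul y z hy hz =>
      obtain ⟨s, hs, m, rfl⟩ := hy
      obtain ⟨s', hs', m', rfl⟩ := hz
      refine ⟨_, S.mul_mem hs (hconj m hs'), m + m', ?_⟩
      rw [zpow_add, map_mul]
      group
  have hSP : S ≤ P.ker := by
    refine sup_le ?_ ?_ <;>
    · rintro _ ⟨a, ha, rfl⟩
      exact (hPj _ a).trans ha
  refine le_antisymm (fun y hy => ?_) hSP
  obtain ⟨s, hs, m, rfl⟩ := hdecomp y
  refine S.mul_mem hs (hjS true ?_)
  rw [Subgroup.mul_mem_cancel_left _ (hSP hs), MonoidHom.mem_ker, hPj] at hy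
  exact hy

/-- Let `F` be the free group on `x, h`, let
`Λ = ⟨h, hxhx⁻², (xhx)h⁻¹(xhx)⁻¹⟩ ≤ F`, and let `G = F *_Λ F` be the amalgamated free
product of two copies of `F` over the inclusion `Λ ↪ F` in each factor, with canonical
injections `j₁, j₂ : F →* G`.  For `n ≥ 2`, `k ∈ ℤ`, and `π_{n,k} : F →* ℤ/n` sending
`x ↦ k`, `h ↦ 1`, the induced homomorphism `P : G →* ℤ/n` with `P ∘ j₁ = P ∘ j₂ = π_{n,k}`
has kernel generated by `j₁ (ker π_{n,k})` and `j₂ (ker π_{n,k})`. -/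
theorem stmt_11 (n : ℕ) (hn : 2 ≤ n) (k : ℤ)
    (x h : FreeGroup Bool) (hx : x = FreeGroup.of true) (hh : h = FreeGroup.of false)
    (Λ : Subgroup (FreeGroup Bool))
    (hΛ : Λ = Subgroup.closure
      {h, h * x * h * x ^ (-2 : ℤ), (x * h * x) * h⁻¹ * (x * h * x)⁻¹})
    (π : FreeGroup Bool →* Multiplicative (ZMod n))
    (hπx : π x = Multiplicative.ofAdd (k : ZMod n))
    (hπh : π h = Multiplicative.ofAdd (1 : ZMod n))
    (P : PushoutI (fun _ : Bool => Λ.subtype) →* Multiplicative (ZMod n))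
    (hP : ∀ i : Bool, P.comp (PushoutI.of (φ := fun _ : Bool => Λ.subtype) i) = π) :
    P.ker =
      Subgroup.map (PushoutI.of (φ := fun _ : Bool => Λ.subtype) true) π.ker ⊔
      Subgroup.map (PushoutI.of (φ := fun _ : Bool => Λ.subtype) false) π.ker := by
  refine ker_double_eq_sup Λ π h ?_ (fun z => ?_) P hP
  · rw [hΛ]
    exact Subgroup.subset_closure (by simp)
  · obtain ⟨m, hm⟩ := ZMod.intCast_surjective z.toAdd
    exact ⟨m, by rw [hπh, ← ofAdd_zsmul, zsmul_one, hm, ofAdd_toAdd]⟩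
end
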